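/- arXiv:1509.02996 — 2 statements merged into one kernel-verified Lean document; each statement's English description precedes it below -/
import Mathlib

section
/- A group G is almost infinite cyclic if and only if there exist a finite-index subgroup G₁ ≤ G and a finite normal subgroup G₂ ⊴ G₁ such that the quotient G₁/G₂ is infinite cyclic. -/
/-- A group is *almost infinite cyclic* if it contains a finite-index subgroup isomorphic to
the infinite cyclic group `ℤ`. -/
def AlmostInfiniteCyclic (G : Type*) [Group G] : Prop :=
  ∃ G₁ : Subgroup G, G₁.FiniteIndex ∧ Nonempty (G₁ ≃* Multiplicative ℤ)

/-- A section of a homomorphism with finite kernel has image of finite index. -/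
theorem MonoidHom.finiteIndex_range_of_rightInverse {H K : Type*} [Group H] [Group K]
    {φ : H →* K} {s : K →* H} (hs : Function.RightInverse s φ) (hφ : (φ.ker : Set H).Finite) :
    s.range.FiniteIndex := by
  have : Finite φ.ker := hφ
  have hsurj : Function.Surjective fun k : φ.ker => ((k : H) : H ⧸ s.range) := by
    intro q
    obtain ⟨g, rfl⟩ := QuotientGroup.mk_surjective q
    refine ⟨⟨g * (s (φ g))⁻¹, by simp [MonoidHom.mem_ker, hs (φ g)]⟩, ?_⟩
    exact QuotientGroup.eq.mpr ⟨φ g, by simp⟩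
  have : Finite (H ⧸ s.range) := Finite.of_surjective _ hsurj
  exact Subgroup.finiteIndex_of_finite_quotient

theorem stmt1 {G : Type*} [Group G] :
    AlmostInfiniteCyclic G ↔
      (∃ G₁ : Subgroup G, G₁.FiniteIndex ∧
        -- a finite normal subgroup `G₂ = ker φ` of `G₁` with `G₁/G₂` infinite cyclic,
        -- encoded via a surjective homomorphism `φ : G₁ → ℤ` with finite kernel
        ∃ φ : G₁ →* Multiplicative ℤ, Function.Surjective φ ∧
          ((φ.ker : Set G₁)).Finite) := by
  constructor
  · rintro ⟨G₁, hG₁, ⟨e⟩⟩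
    refine ⟨G₁, hG₁, e.toMonoidHom, e.surjective, ?_⟩
    rw [MonoidHom.ker_eq_bot_iff _ |>.mpr e.injective]
    exact Set.finite_singleton 1
  · rintro ⟨G₁, hG₁, φ, hφ, hker⟩
    obtain ⟨t, ht⟩ := hφ (Multiplicative.ofAdd 1)
    let s : Multiplicative ℤ →* G₁ := zpowersHom G₁ t
    have hs : Function.RightInverse s φ := by
      intro n
      rw [zpowersHom_apply, map_zpow, ht, ← ofAdd_zsmul, smul_eq_mul, mul_one, ofAdd_toAdd]
    have hfin := MonoidHom.finiteIndex_range_of_rightInverse hs hker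
    have hinj : Function.Injective (G₁.subtype.comp s) :=
      G₁.subtype_injective.comp hs.injective
    refine ⟨(G₁.subtype.comp s).range, ?_, ⟨(MonoidHom.ofInjective hinj).symm⟩⟩
    rw [MonoidHom.range_comp, Subgroup.finiteIndex_iff, Subgroup.index_map_subtype]
    exact mul_ne_zero hfin.index_ne_zero hG₁.index_ne_zero
end

section
/- Let G be a subgroup of GL_n(ℂ) and let N be a normal subgroup of G such that both N and the quotient group G/N are virtually solvable. Then G is virtually solvable. -/
/-- A group is *virtually solvable* if it contains a solvable subgroup of finite index. -/
def VirtuallySolvable (G : Type*) [Group G] : Prop :=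
  ∃ S : Subgroup G, S.FiniteIndex ∧ IsSolvable S

/-- A subgroup `K` is solvable if its image under a homomorphism and the part of the kernel
in `K` are solvable. -/
theorem Subgroup.isSolvable_of_isSolvable_map {G H : Type*} [Group G] [Group H] (f : G →* H)
    (K : Subgroup G) (hker : Group.IsSolvable (f.ker.subgroupOf K)) (hmap : Group.IsSolvable (K.map f)) :
    Group.IsSolvable K := by
  refine Group.isSolvable_of_ker_le_range (f.ker.subgroupOf K).subtype (f.subgroupMap K) ?_
  intro x hx
  rw [Subgroup.range_subtype, Subgroup.mem_subgroupOf, MonoidHom.mem_ker]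
  exact congrArg Subtype.val (MonoidHom.mem_ker.mp hx)

theorem Subgroup.isSolvable_of_le {G : Type*} [Group G] {H K : Subgroup G} (h : H ≤ K)
    (hK : Group.IsSolvable K) : Group.IsSolvable H :=
  Group.isSolvable_of_isSolvable_injective (Subgroup.inclusion_injective h)

theorem Subgroup.isSolvable_map {G H : Type*} [Group G] [Group H] (f : G →* H) (K : Subgroup G)
    (hK : Group.IsSolvable K) : Group.IsSolvable (K.map f) :=
  Group.isSolvable_of_surjective (f.subgroupMap_surjective K)

theorem Subgroup.isSolvable_subgroupOf {G : Type*} [Group G] {H : Subgroup G} (K : Subgroup G)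
    (hH : Group.IsSolvable H) : Group.IsSolvable (H.subgroupOf K) :=
  Group.isSolvable_of_isSolvable_injective (f := K.subtype.subgroupComap H) fun _ _ hxy =>
    Subtype.ext (Subtype.ext (congrArg (fun z : H => (z : G)) hxy))

theorem Subgroup.isSolvable_sup {G : Type*} [Group G] (S T : Subgroup G) [S.Normal]
    (hS : Group.IsSolvable S) (hT : Group.IsSolvable T) : Group.IsSolvable (S ⊔ T : Subgroup G) := by
  refine Subgroup.isSolvable_of_isSolvable_map (QuotientGroup.mk' S) _ ?_ ?_
  · rw [QuotientGroup.ker_mk']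
    exact Subgroup.isSolvable_subgroupOf _ hS
  · rw [Subgroup.map_sup, QuotientGroup.map_mk'_self, bot_sup_eq]
    exact Subgroup.isSolvable_map _ T hT

/-- A virtually solvable group has a largest normal solvable subgroup; it is characteristic
and of finite index. -/
theorem VirtuallySolvable.exists_characteristic {G : Type*} [Group G]
    (h : VirtuallySolvable G) :
    ∃ M : Subgroup G, M.Characteristic ∧ M.FiniteIndex ∧ Group.IsSolvable M := by
  obtain ⟨S, hSfin, hS⟩ := h
  let P : Set (Subgroup G) := {M | M.Normal ∧ M.FiniteIndex ∧ Group.IsSolvable M}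
  have hP : P.Nonempty := ⟨S.normalCore, inferInstance, inferInstance,
    Subgroup.isSolvable_of_le S.normalCore_le hS⟩
  let M := Function.argminOn Subgroup.index P hP
  obtain ⟨hMn, hMfin, hM⟩ : M ∈ P := Function.argminOn_mem _ _ _
  have hmax : ∀ T : Subgroup G, T.Normal → Group.IsSolvable T → T ≤ M := by
    intro T hTn hT
    have hle : M ≤ M ⊔ T := le_sup_left
    have hmem : M ⊔ T ∈ P :=
      ⟨inferInstance, Subgroup.finiteIndex_of_le hle, Subgroup.isSolvable_sup M T hM hT⟩
    have hidx : M.index ≤ (M ⊔ T).index := Function.argminOn_le Subgroup.index P hmem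
    have heq : M = M ⊔ T := by
      by_contra hne
      exact absurd (Subgroup.index_strictAnti (lt_of_le_of_ne hle hne)) (not_lt.mpr hidx)
    rw [heq]
    exact le_sup_right
  refine ⟨M, Subgroup.characteristic_iff_map_le.mpr fun φ => hmax _ ?_ ?_, hMfin, hM⟩
  · exact hMn.map _ φ.surjective
  · exact Subgroup.isSolvable_map _ M hM

theorem Subgroup.finiteIndex_comap {G H : Type*} [Group G] [Group H] (T : Subgroup H)
    [T.FiniteIndex] (f : G →* H) : (T.comap f).FiniteIndex :=
  ⟨by
    rw [Subgroup.index_comap]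
    exact fun h => Subgroup.FiniteIndex.index_ne_zero (Subgroup.index_eq_zero_of_relIndex_eq_zero h)⟩

/-- An extension of a virtually solvable group by a solvable group is virtually solvable. -/
theorem VirtuallySolvable.of_isSolvable_ker {G H : Type*} [Group G] [Group H] (f : G →* H)
    (hker : Group.IsSolvable f.ker) (hH : VirtuallySolvable H) : VirtuallySolvable G := by
  obtain ⟨T, hTfin, hT⟩ := hH
  refine ⟨T.comap f, T.finiteIndex_comap f, Subgroup.isSolvable_of_isSolvable_map f _ ?_ ?_⟩
  · exact Subgroup.isSolvable_subgroupOf _ hker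
  · exact Subgroup.isSolvable_of_le (Subgroup.map_comap_le f T) hT

/-- An extension of a virtually solvable group by a finite group is virtually solvable. -/
theorem VirtuallySolvable.of_finite_ker {G H : Type*} [Group G] [Group H] (f : G →* H)
    (hker : Finite f.ker) (hH : VirtuallySolvable H) : VirtuallySolvable G := by
  obtain ⟨T, hTfin, hT⟩ := hH
  let c : G →* MulAut f.ker := MulAut.conjNormal
  have : Finite (MulAut f.ker) := Finite.of_injective _ DFunLike.coe_injective
  have : c.ker.FiniteIndex := inferInstance
  have : (T.comap f).FiniteIndex := T.finiteIndex_comap f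
  refine ⟨c.ker ⊓ T.comap f, inferInstance, Subgroup.isSolvable_of_isSolvable_map f _ ?_ ?_⟩
  · refine Group.isSolvable_of_comm fun x y => ?_
    have hx : c x.1.1 = 1 := x.1.2.1
    have hxy := congrArg Subtype.val (DFunLike.congr_fun hx ⟨y.1.1, y.2⟩)
    refine Subtype.ext (Subtype.ext ?_)
    exact mul_inv_eq_iff_eq_mul.mp hxy
  · refine Subgroup.isSolvable_of_le ?_ hT
    exact (Subgroup.map_mono inf_le_right).trans (Subgroup.map_comap_le f T)

/-- An extension of a virtually solvable group by a virtually solvable group is virtually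
solvable. -/
theorem VirtuallySolvable.of_normal {G : Type*} [Group G] (N : Subgroup G) [N.Normal]
    (hN : VirtuallySolvable N) (hQ : VirtuallySolvable (G ⧸ N)) : VirtuallySolvable G := by
  obtain ⟨M, hMc, hMfin, hM⟩ := hN.exists_characteristic
  let M' : Subgroup G := M.map N.subtype
  have hM'n : M'.Normal := inferInstance
  have hM'N : M' ≤ N := Subgroup.map_subtype_le M
  refine VirtuallySolvable.of_isSolvable_ker (QuotientGroup.mk' M') ?_ ?_
  · rw [QuotientGroup.ker_mk']
    exact Subgroup.isSolvable_map _ M hM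
  let g : N →* G ⧸ M' := (QuotientGroup.mk' M').comp N.subtype
  have hMg : M ≤ g.ker := fun x hx =>
    (QuotientGroup.eq_one_iff (x : G)).mpr (Subgroup.mem_map_of_mem N.subtype hx)
  have hgfin : g.ker.FiniteIndex := Subgroup.finiteIndex_of_le hMg
  have hgran : Finite g.range := by
    refine Nat.finite_of_card_ne_zero ?_
    rw [← Subgroup.index_ker]
    exact hgfin.index_ne_zero
  refine VirtuallySolvable.of_finite_ker
    (QuotientGroup.lift M' (QuotientGroup.mk' N) (by rwa [QuotientGroup.ker_mk'])) ?_ hQ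
  refine Finite.Set.subset (g.range : Set (G ⧸ M')) ?_
  intro q hq
  obtain ⟨x, rfl⟩ := QuotientGroup.mk_surjective q
  exact ⟨⟨x, (QuotientGroup.eq_one_iff x).mp hq⟩, rfl⟩

theorem stmt18 {n : ℕ} (G : Subgroup (Matrix.GeneralLinearGroup (Fin n) ℂ))
    (N : Subgroup G) [N.Normal]
    (hN : VirtuallySolvable N)
    (hQ : VirtuallySolvable (G ⧸ N)) :
    VirtuallySolvable G :=
  VirtuallySolvable.of_normal N hN hQ
end
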